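/- Let O ⊆ ℝⁿ be open, T > 0, and u : O × (0,T) → ℝ be continuous. Let φ : ℝ × [0,T) → ℝ be C^{2,1} with ∂_r φ ≥ 0 (derivative in the first variable), and let Ψ : ℝ × [0,T) → ℝ be continuous and satisfy φ(Ψ(u(y,t),t),t) = u(y,t) for all (y,t) ∈ O × (0,T) and Ψ(φ(r,t),t) = r for all r in the range of Ψ(u(·,t),t). If (τ, p, X) belongs to the closure P̄^{2,+} of the superjet of the function (y,t) ↦ Ψ(u(y,t),t) at a point (y₀,t₀) ∈ O × (0,T), then (φ_t + φ′τ, φ′p, φ″ p⊗p + φ′X) ∈ P̄^{2,+} u(y₀,t₀), where φ_t, φ′, φ″ denote the t-derivative and the first and second derivatives of φ in its first variable, all evaluated at (Ψ(u(y₀,t₀),t₀), t₀). -/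

import Mathlib

open Set Filter Topology

/-- The parabolic second-order superjet `P^{2,+} u (z)` of `u` at a point `z` of the
parabolic domain `O × (0,T)`: triples `(∂ₜφ(z), Dφ(z), D²φ(z))` where `φ` is `C^{2,1}`
on `O × (0,T)` (once continuously differentiable in `t`, twice continuously
differentiable in `x`) and `u − φ` attains a local maximum at `z`. -/
def ParabolicSuperjet {n : ℕ} (O : Set (EuclideanSpace ℝ (Fin n))) (T : ℝ)
    (u : EuclideanSpace ℝ (Fin n) × ℝ → ℝ) (z : EuclideanSpace ℝ (Fin n) × ℝ) :
    Set (ℝ × (EuclideanSpace ℝ (Fin n) →L[ℝ] ℝ) ×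
      (EuclideanSpace ℝ (Fin n) →L[ℝ] EuclideanSpace ℝ (Fin n) →L[ℝ] ℝ)) :=
  {j | ∃ (φ φt : EuclideanSpace ℝ (Fin n) × ℝ → ℝ)
      (Dφ : EuclideanSpace ℝ (Fin n) × ℝ → (EuclideanSpace ℝ (Fin n) →L[ℝ] ℝ))
      (D2φ : EuclideanSpace ℝ (Fin n) × ℝ →
        (EuclideanSpace ℝ (Fin n) →L[ℝ] EuclideanSpace ℝ (Fin n) →L[ℝ] ℝ)),
    (∀ w ∈ O ×ˢ Ioo (0 : ℝ) T, HasDerivAt (fun s => φ (w.1, s)) (φt w) w.2) ∧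
    (∀ w ∈ O ×ˢ Ioo (0 : ℝ) T, HasFDerivAt (fun x => φ (x, w.2)) (Dφ w) w.1) ∧
    (∀ w ∈ O ×ˢ Ioo (0 : ℝ) T, HasFDerivAt (fun x => Dφ (x, w.2)) (D2φ w) w.1) ∧
    ContinuousOn φt (O ×ˢ Ioo (0 : ℝ) T) ∧
    ContinuousOn Dφ (O ×ˢ Ioo (0 : ℝ) T) ∧
    ContinuousOn D2φ (O ×ˢ Ioo (0 : ℝ) T) ∧
    IsLocalMax (fun w => u w - φ w) z ∧
    j = (φt z, Dφ z, D2φ z)}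

/-- The closure `P̄^{2,+} u (z)` of the parabolic superjet: all `(τ,p,X)` which are
limits of jets `(τⱼ,pⱼ,Xⱼ) ∈ P^{2,+} u (zⱼ)` at points `zⱼ ∈ O × (0,T)` with
`zⱼ → z` and `u(zⱼ) → u(z)`. -/
def ParabolicSuperjetClosure {n : ℕ} (O : Set (EuclideanSpace ℝ (Fin n))) (T : ℝ)
    (u : EuclideanSpace ℝ (Fin n) × ℝ → ℝ) (z : EuclideanSpace ℝ (Fin n) × ℝ) :
    Set (ℝ × (EuclideanSpace ℝ (Fin n) →L[ℝ] ℝ) ×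
      (EuclideanSpace ℝ (Fin n) →L[ℝ] EuclideanSpace ℝ (Fin n) →L[ℝ] ℝ)) :=
  {j | ∃ (zs : ℕ → EuclideanSpace ℝ (Fin n) × ℝ)
      (js : ℕ → ℝ × (EuclideanSpace ℝ (Fin n) →L[ℝ] ℝ) ×
        (EuclideanSpace ℝ (Fin n) →L[ℝ] EuclideanSpace ℝ (Fin n) →L[ℝ] ℝ)),
    (∀ k, zs k ∈ O ×ˢ Ioo (0 : ℝ) T) ∧
    (∀ k, js k ∈ ParabolicSuperjet O T u (zs k)) ∧
    Filter.Tendsto zs Filter.atTop (nhds z) ∧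
    Filter.Tendsto (fun k => u (zs k)) Filter.atTop (nhds (u z)) ∧
    Filter.Tendsto js Filter.atTop (nhds j)}

/-- A function on an open subset of `E × ℝ` with continuous partial derivatives is strictly
differentiable there. -/
theorem hasStrictFDerivAt_of_continuousOn_partial {E : Type*} [NormedAddCommGroup E]
    [NormedSpace ℝ E] {U : Set (E × ℝ)} (hU : IsOpen U) {f ft : E × ℝ → ℝ}
    {Df : E × ℝ → (E →L[ℝ] ℝ)}
    (hft : ∀ w ∈ U, HasDerivAt (fun s => f (w.1, s)) (ft w) w.2)
    (hDf : ∀ w ∈ U, HasFDerivAt (fun x => f (x, w.2)) (Df w) w.1)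
    (hftc : ContinuousOn ft U) (hDfc : ContinuousOn Df U) {w : E × ℝ} (hw : w ∈ U) :
    HasStrictFDerivAt f ((Df w).coprod (ContinuousLinearMap.toSpanSingleton ℝ (ft w))) w := by
  have hUw : U ∈ 𝓝 w := hU.mem_nhds hw
  exact hasStrictFDerivAt_uncurry_coprod (f := fun x t => f (x, t)) (f₁ := fun x t => Df (x, t))
    (f₂ := fun x t => ContinuousLinearMap.toSpanSingleton ℝ (ft (x, t)))
    (Filter.mem_of_superset hUw fun v hv => hDf v hv)
    (Filter.mem_of_superset hUw fun v hv => (hft v hv).hasFDerivAt)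
    (hDfc.continuousAt hUw)
    ((ContinuousLinearMap.toSpanSingletonCLE (𝕜 := ℝ) (E := ℝ)).continuous.continuousAt.comp
      (hftc.continuousAt hUw))

/-- The combination `a p ⊗ q + b X` depends continuously on its ingredients. -/
theorem Filter.Tendsto.smul_smulRight_add_smul {α E F : Type*} [NormedAddCommGroup E]
    [NormedSpace ℝ E] [NormedAddCommGroup F] [NormedSpace ℝ F] {l : Filter α} {a b : α → ℝ}
    {p : α → E →L[ℝ] ℝ} {q : α → F} {X : α → E →L[ℝ] F} {a₀ b₀ : ℝ} {p₀ : E →L[ℝ] ℝ} {q₀ : F}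
    {X₀ : E →L[ℝ] F} (ha : Tendsto a l (𝓝 a₀)) (hb : Tendsto b l (𝓝 b₀))
    (hp : Tendsto p l (𝓝 p₀)) (hq : Tendsto q l (𝓝 q₀)) (hX : Tendsto X l (𝓝 X₀)) :
    Tendsto (fun k => a k • (p k).smulRight (q k) + b k • X k) l
      (𝓝 (a₀ • p₀.smulRight q₀ + b₀ • X₀)) := by
  have h : Continuous fun w : (E →L[ℝ] ℝ) × F => w.1.smulRight w.2 :=
    ((ContinuousLinearMap.smulRightL ℝ E F).continuous.comp continuous_fst).clm_apply
      continuous_snd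
  exact (ha.smul ((h.tendsto (p₀, q₀)).comp (hp.prodMk_nhds hq))).add (hb.smul hX)

/-- Superjets transform by the chain rule under composition with a `C^{2,1}` function that is
nondecreasing in its first variable. -/
theorem ParabolicSuperjet.comp_monotone {n : ℕ} {O : Set (EuclideanSpace ℝ (Fin n))}
    (hO : IsOpen O) {T : ℝ} {u v : EuclideanSpace ℝ (Fin n) × ℝ → ℝ} {φ φt φr φrr : ℝ × ℝ → ℝ}
    (hφt : ∀ w ∈ univ ×ˢ Ioo (0 : ℝ) T, HasDerivAt (fun s => φ (w.1, s)) (φt w) w.2)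
    (hφr : ∀ w ∈ univ ×ˢ Ioo (0 : ℝ) T, HasDerivAt (fun ρ => φ (ρ, w.2)) (φr w) w.1)
    (hφrr : ∀ w ∈ univ ×ˢ Ioo (0 : ℝ) T, HasDerivAt (fun ρ => φr (ρ, w.2)) (φrr w) w.1)
    (hφtc : ContinuousOn φt (univ ×ˢ Ioo 0 T))
    (hφrc : ContinuousOn φr (univ ×ˢ Ioo 0 T))
    (hφrrc : ContinuousOn φrr (univ ×ˢ Ioo 0 T))
    (hmono : ∀ t ∈ Ioo (0 : ℝ) T, Monotone fun r => φ (r, t))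
    (huv : ∀ w ∈ O ×ˢ Ioo (0 : ℝ) T, u w = φ (v w, w.2))
    {z : EuclideanSpace ℝ (Fin n) × ℝ} (hz : z ∈ O ×ˢ Ioo (0 : ℝ) T)
    {j : ℝ × (EuclideanSpace ℝ (Fin n) →L[ℝ] ℝ) ×
      (EuclideanSpace ℝ (Fin n) →L[ℝ] EuclideanSpace ℝ (Fin n) →L[ℝ] ℝ)}
    (hj : j ∈ ParabolicSuperjet O T v z) :
    (φt (v z, z.2) + φr (v z, z.2) * j.1, φr (v z, z.2) • j.2.1,
      φrr (v z, z.2) • j.2.1.smulRight j.2.1 + φr (v z, z.2) • j.2.2)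
      ∈ ParabolicSuperjet O T u z := by
  obtain ⟨g, gt, Dg, D2g, hgt, hDg, hD2g, hgtc, hDgc, hD2gc, hmax, rfl⟩ := hj
  have hU : IsOpen (O ×ˢ Ioo (0 : ℝ) T) := hO.prod isOpen_Ioo
  have hφd : ∀ w ∈ univ ×ˢ Ioo (0 : ℝ) T, HasFDerivAt φ
      ((ContinuousLinearMap.toSpanSingleton ℝ (φr w)).coprod
        (ContinuousLinearMap.toSpanSingleton ℝ (φt w))) w := fun w hw =>
    (hasStrictFDerivAt_of_continuousOn_partial (isOpen_univ.prod isOpen_Ioo) hφt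
      (fun w hw => (hφr w hw).hasFDerivAt) hφtc
      ((ContinuousLinearMap.toSpanSingletonCLE (𝕜 := ℝ) (E := ℝ)).continuous.comp_continuousOn
        hφrc) hw).hasFDerivAt
  have hgc : ContinuousOn g (O ×ˢ Ioo (0 : ℝ) T) := fun w hw =>
    (hasStrictFDerivAt_of_continuousOn_partial hU hgt hDg hgtc hDgc
      hw).hasFDerivAt.continuousAt.continuousWithinAt
  set c := v z - g z with hc
  let G : EuclideanSpace ℝ (Fin n) × ℝ → ℝ × ℝ := fun w => (g w + c, w.2)
  have hGc : ContinuousOn G (O ×ˢ Ioo (0 : ℝ) T) :=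
    (hgc.add continuousOn_const).prodMk continuousOn_snd
  have hGm : MapsTo G (O ×ˢ Ioo (0 : ℝ) T) (univ ×ˢ Ioo (0 : ℝ) T) :=
    fun w hw => ⟨mem_univ _, hw.2⟩
  have hGz : G z = (v z, z.2) := by simp [G, hc]
  have hφrG : ContinuousOn (fun w => φr (G w)) (O ×ˢ Ioo (0 : ℝ) T) := hφrc.comp hGc hGm
  refine ⟨fun w => φ (G w), fun w => φt (G w) + φr (G w) * gt w, fun w => φr (G w) • Dg w,
    fun w => φrr (G w) • (Dg w).smulRight (Dg w) + φr (G w) • D2g w,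
    fun w hw => ?_, fun w hw => ?_, fun w hw => ?_, ?_, ?_, ?_, ?_, ?_⟩
  · have h := (hφd (G w) (hGm hw)).comp_hasDerivAt (f := fun s => G (w.1, s)) w.2
      (((hgt w hw).add_const c).prodMk (hasDerivAt_id w.2))
    refine h.congr_deriv ?_
    simp [mul_comm, add_comm]
  · exact (hφr (G w) (hGm hw)).comp_hasFDerivAt w.1 ((hDg w hw).add_const c)
  · have h := ((hφrr (G w) (hGm hw)).comp_hasFDerivAt w.1 ((hDg w hw).add_const c)).smul
      (hD2g w hw)
    refine h.congr_fderiv ?_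
    ext x y
    simp [G, mul_assoc]
    ring
  · exact (hφtc.comp hGc hGm).add (hφrG.mul hgtc)
  · exact hφrG.smul hDgc
  · exact fun w hw => Filter.Tendsto.smul_smulRight_add_smul
      (hφrrc.comp hGc hGm w hw) (hφrG w hw) (hDgc w hw) (hDgc w hw) (hD2gc w hw)
  · filter_upwards [hmax, hU.mem_nhds hz] with w hw hwU
    have hle : φ (v w, w.2) ≤ φ (G w) := hmono w.2 hwU.2 (by linarith)
    simp only [huv w hwU, huv z hz, hGz]
    linarith
  · simp only [hGz]

/-- Let `O ⊆ ℝⁿ` be open, `T > 0`, `u` continuous on `O × (0,T)`.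
Let `φ : ℝ × [0,T) → ℝ` be `C^{2,1}` with `∂ᵣφ ≥ 0`, and `Ψ` satisfy
`φ(Ψ(u(y,t),t),t) = u(y,t)` on `O × (0,T)` and `Ψ(φ(r,t),t) = r` for `r` in the range
of `Ψ(u(·,t),t)`.  Assume moreover `Ψ` is continuous.
If `(τ,p,X) ∈ P̄^{2,+}` of `(y,t) ↦ Ψ(u(y,t),t)` at
`(y₀,t₀) ∈ O × (0,T)`, then
`(φₜ + φ′τ, φ′p, φ″ p⊗p + φ′X) ∈ P̄^{2,+} u (y₀,t₀)`, derivatives of `φ` evaluated at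
`(Ψ(u(y₀,t₀),t₀), t₀)`. -/
theorem superjetClosure_comp_increasing (n : ℕ)
    (O : Set (EuclideanSpace ℝ (Fin n))) (hO : IsOpen O) (T : ℝ) (hT : 0 < T)
    (u : EuclideanSpace ℝ (Fin n) × ℝ → ℝ) (hu : ContinuousOn u (O ×ˢ Ioo 0 T))
    (φ φt φr φrr : ℝ × ℝ → ℝ) (Ψ : ℝ × ℝ → ℝ)
    (hφt : ∀ r : ℝ, ∀ t ∈ Ico (0 : ℝ) T,
      HasDerivWithinAt (fun s => φ (r, s)) (φt (r, t)) (Ico 0 T) t)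
    (hφr : ∀ r : ℝ, ∀ t ∈ Ico (0 : ℝ) T, HasDerivAt (fun ρ => φ (ρ, t)) (φr (r, t)) r)
    (hφrr : ∀ r : ℝ, ∀ t ∈ Ico (0 : ℝ) T, HasDerivAt (fun ρ => φr (ρ, t)) (φrr (r, t)) r)
    (hφc : ContinuousOn φ (univ ×ˢ Ico 0 T))
    (hφtc : ContinuousOn φt (univ ×ˢ Ico 0 T))
    (hφrc : ContinuousOn φr (univ ×ˢ Ico 0 T))
    (hφrrc : ContinuousOn φrr (univ ×ˢ Ico 0 T))
    (hmono : ∀ r : ℝ, ∀ t ∈ Ico (0 : ℝ) T, 0 ≤ φr (r, t))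
    (hinv : ∀ y ∈ O, ∀ t ∈ Ioo (0 : ℝ) T, φ (Ψ (u (y, t), t), t) = u (y, t))
    (hΨc : ContinuousOn Ψ (univ ×ˢ Ico 0 T))
    (hinv' : ∀ t ∈ Ioo (0 : ℝ) T, ∀ r : ℝ,
      (∃ y ∈ O, r = Ψ (u (y, t), t)) → Ψ (φ (r, t), t) = r)
    (y₀ : EuclideanSpace ℝ (Fin n)) (t₀ : ℝ) (hy₀ : y₀ ∈ O) (ht₀ : t₀ ∈ Ioo 0 T)
    (τ : ℝ) (p : EuclideanSpace ℝ (Fin n) →L[ℝ] ℝ)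
    (X : EuclideanSpace ℝ (Fin n) →L[ℝ] EuclideanSpace ℝ (Fin n) →L[ℝ] ℝ)
    (hjet : (τ, p, X) ∈ ParabolicSuperjetClosure O T (fun w => Ψ (u w, w.2)) (y₀, t₀)) :
    (φt (Ψ (u (y₀, t₀), t₀), t₀) + φr (Ψ (u (y₀, t₀), t₀), t₀) * τ,
      φr (Ψ (u (y₀, t₀), t₀), t₀) • p,
      φrr (Ψ (u (y₀, t₀), t₀), t₀) • p.smulRight p
        + φr (Ψ (u (y₀, t₀), t₀), t₀) • X)
      ∈ ParabolicSuperjetClosure O T u (y₀, t₀) := by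
  obtain ⟨zs, js, hzs, hjs, hz, hv, hj⟩ := hjet
  have hIoo : (univ : Set ℝ) ×ˢ Ioo (0 : ℝ) T ⊆ univ ×ˢ Ico 0 T :=
    prod_mono_right Ioo_subset_Ico_self
  have hz₀ : (y₀, t₀) ∈ O ×ˢ Ioo (0 : ℝ) T := ⟨hy₀, ht₀⟩
  have hU : O ×ˢ Ioo (0 : ℝ) T ∈ 𝓝 (y₀, t₀) := (hO.prod isOpen_Ioo).mem_nhds hz₀
  have hjs' := fun k => ParabolicSuperjet.comp_monotone (φ := φ) (φt := φt) (φr := φr)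
    (φrr := φrr) (u := u) hO
    (fun w hw => (hφt w.1 w.2 (hIoo hw).2).hasDerivAt (Ico_mem_nhds hw.2.1 hw.2.2))
    (fun w hw => hφr w.1 w.2 (hIoo hw).2) (fun w hw => hφrr w.1 w.2 (hIoo hw).2)
    (hφtc.mono hIoo) (hφrc.mono hIoo) (hφrrc.mono hIoo)
    (fun t ht => monotone_of_hasDerivAt_nonneg
      (fun r => hφr r t (Ioo_subset_Ico_self ht)) fun r => hmono r t (Ioo_subset_Ico_self ht))
    (fun w hw => (hinv w.1 hw.1 w.2 hw.2).symm) (hzs k) (hjs k)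
  refine ⟨zs, _, hzs, hjs', hz, (hu.continuousAt hU).tendsto.comp hz, ?_⟩
  have hw : Tendsto (fun k => (Ψ (u (zs k), (zs k).2), (zs k).2)) atTop
      (𝓝 (Ψ (u (y₀, t₀), t₀), t₀)) := hv.prodMk_nhds ((continuous_snd.tendsto _).comp hz)
  have hlim : ∀ f : ℝ × ℝ → ℝ, ContinuousOn f (univ ×ˢ Ico 0 T) →
      Tendsto (fun k => f (Ψ (u (zs k), (zs k).2), (zs k).2)) atTop
        (𝓝 (f (Ψ (u (y₀, t₀), t₀), t₀))) := fun f hf =>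
    (hf.continuousAt (prod_mem_nhds univ_mem (Ico_mem_nhds ht₀.1 ht₀.2))).tendsto.comp hw
  have hτ : Tendsto (fun k => (js k).1) atTop (𝓝 τ) := hj.fst_nhds
  have hp : Tendsto (fun k => (js k).2.1) atTop (𝓝 p) := hj.snd_nhds.fst_nhds
  have hX : Tendsto (fun k => (js k).2.2) atTop (𝓝 X) := hj.snd_nhds.snd_nhds
  exact ((hlim φt hφtc).add ((hlim φr hφrc).mul hτ)).prodMk_nhds
    (((hlim φr hφrc).smul hp).prodMk_nhds
      ((hlim φrr hφrrc).smul_smulRight_add_smul (hlim φr hφrc) hp hp hX))
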